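/- For every tapped ratio α with 0 < α ≤ 2 and a library of D = 2 files, the strong secrecy capacity of the caching broadcast channel with a wire and cache tapping adversary of type II equals C_s(α) = 1 − α/2. -/

import Mathlib

open scoped BigOperators
open Filter

namespace CBC

/-- The distribution of a random variable `X` on a finite sample space with
probability mass function `P`. -/
noncomputable def dist {Ω A : Type*} [Fintype Ω] [DecidableEq A]
    (P : Ω → ℝ) (X : Ω → A) (a : A) : ℝ :=
  ∑ ω, if X ω = a then P ω else 0

/-- Mutual information `I(X;Y)` of two finite-valued random variables on a finite
sample space with probability mass function `P`:
`I(X;Y) = Σ_{a,b} P(X=a,Y=b) log ( P(X=a,Y=b) / (P(X=a) P(Y=b)) )`. -/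
noncomputable def mutInfo {Ω A B : Type*} [Fintype Ω] [Fintype A] [Fintype B]
    [DecidableEq A] [DecidableEq B] (P : Ω → ℝ) (X : Ω → A) (Y : Ω → B) : ℝ :=
  ∑ a : A, ∑ b : B,
    dist P (fun ω => (X ω, Y ω)) (a, b) *
      Real.log (dist P (fun ω => (X ω, Y ω)) (a, b) / (dist P X a * dist P Y b))

/-- A channel code for the caching broadcast channel with a wire and cache tapping
adversary of type II (CBC-WCT II), with library size `D`, blocklength `n`,
message-set size `M` (so each file is uniform over `Fin M`, representing
`[1:2^{nR_s}]`) and cache size `C` (representing `[1:2^{n/2}]`).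
Encoders may use private randomness: a finite randomness alphabet `Fin (nr+1)`
with probability mass function `q`. -/
structure Code (D n M C : ℕ) where
  /-- size (minus one) of the encoder's private randomness alphabet -/
  nr : ℕ
  /-- probability mass function of the encoder's private randomness -/
  q : Fin (nr + 1) → ℝ
  q_nonneg : ∀ θ, 0 ≤ q θ
  q_sum : ∑ θ, q θ = 1
  /-- cache placement encoder: sends `X_c^n ∈ {0,1}^n` as a (stochastic) function
  of the library files -/
  encC : (Fin D → Fin M) → Fin (nr + 1) → (Fin n → Bool)
  /-- cache decoder of receiver `j ∈ {1,2}`: stores `M_{c,j} = f_{c,j}(X_c^n)` -/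
  cacheF : Fin 2 → (Fin n → Bool) → Fin C
  /-- delivery encoder for demand vector `d = (d₁,d₂)`: sends `X_d^n ∈ {0,1}^n` -/
  encD : Fin D × Fin D → (Fin D → Fin M) → Fin (nr + 1) → (Fin n → Bool)
  /-- decoder of receiver `j`: `Ŵ_{d_j} = g_{d,j}(M_{c,j}, X_d^n)` -/
  dec : Fin D × Fin D → Fin 2 → Fin C → (Fin n → Bool) → Fin M

/-- The joint probability mass function of the (independent, uniform) library files
and the encoder randomness. -/
noncomputable def Code.P {D n M C : ℕ} (c : Code D n M C) :
    ((Fin D → Fin M) × Fin (c.nr + 1)) → ℝ :=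
  fun ωθ => (1 / (M : ℝ) ^ D) * c.q ωθ.2

/-- Probability of decoding error under demand vector `d`:
`P(Ŵ_{d₁} ≠ W_{d₁} or Ŵ_{d₂} ≠ W_{d₂})`. -/
noncomputable def Code.errProb {D n M C : ℕ} (c : Code D n M C)
    (d : Fin D × Fin D) : ℝ :=
  ∑ ωθ : (Fin D → Fin M) × Fin (c.nr + 1),
    if c.dec d 0 (c.cacheF 0 (c.encC ωθ.1 ωθ.2)) (c.encD d ωθ.1 ωθ.2) ≠ ωθ.1 d.1 ∨
       c.dec d 1 (c.cacheF 1 (c.encC ωθ.1 ωθ.2)) (c.encD d ωθ.1 ωθ.2) ≠ ωθ.1 d.2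
    then c.P ωθ else 0

/-- The adversary's observation of a length-`n` binary word when tapping the
positions in `S`: position `i` shows the transmitted bit if `i ∈ S` and the
erasure symbol `?` (here `none`) otherwise. -/
def tap {n : ℕ} (S : Finset (Fin n)) (x : Fin n → Bool) : Fin n → Option Bool :=
  fun i => if i ∈ S then some (x i) else none

/-- Information leakage `I(W₁,…,W_D ; Z_{S₁}^n, Z_{S₂}^n)` to an adversary tapping
positions `S₁` of the cache placement transmission and `S₂` of the delivery
transmission, under demand vector `d`. -/
noncomputable def Code.leak {D n M C : ℕ} (c : Code D n M C)
    (d : Fin D × Fin D) (S1 S2 : Finset (Fin n)) : ℝ :=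
  mutInfo c.P (fun ωθ => ωθ.1)
    (fun ωθ => (tap S1 (c.encC ωθ.1 ωθ.2), tap S2 (c.encD d ωθ.1 ωθ.2)))

/-- Number of messages per file at blocklength `n` and file rate `R`: `2^{nR}`. -/
noncomputable def msgCount (n : ℕ) (R : ℝ) : ℕ := ⌊(2 : ℝ) ^ ((n : ℝ) * R)⌋₊

/-- Size of each receiver's cache memory at blocklength `n`: `2^{n/2}`
(a cache of `n/2` bits). -/
noncomputable def cacheSize (n : ℕ) : ℕ := ⌊(2 : ℝ) ^ ((n : ℝ) / 2)⌋₊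

/-- The file rate `R` is achievable with strong secrecy with respect to the family
`Allowed` of admissible adversary tapping-set pairs `(S₁,S₂)`: there is a sequence
of codes whose worst-case (over demand vectors) error probability vanishes and
whose worst-case (over demand vectors and allowed tapping sets) information
leakage vanishes as `n → ∞`. -/
def AchievableW (D : ℕ)
    (Allowed : (n : ℕ) → Finset (Fin n) → Finset (Fin n) → Prop) (R : ℝ) : Prop :=
  ∃ (c : ∀ n : ℕ, Code D n (msgCount n R) (cacheSize n)) (ε δ : ℕ → ℝ),
    Tendsto ε atTop (nhds 0) ∧ Tendsto δ atTop (nhds 0) ∧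
    (∀ n, ∀ d : Fin D × Fin D, (c n).errProb d ≤ ε n) ∧
    (∀ n, ∀ d : Fin D × Fin D, ∀ S1 S2 : Finset (Fin n), Allowed n S1 S2 →
      |(c n).leak d S1 S2| ≤ δ n)

/-- The file rate `R` is achievable with strong secrecy against an adversary of
type II who may tap any sets `S₁, S₂ ⊆ [1:n]` with `|S₁| + |S₂| ≤ μ = αn`. -/
def Achievable (D : ℕ) (α : ℝ) (R : ℝ) : Prop :=
  AchievableW D (fun n S1 S2 => ((S1.card : ℝ) + (S2.card : ℝ)) ≤ α * n) R

/-- The strong secrecy capacity `C_s(α)` of the CBC-WCT II with library size `D`: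
the supremum of all file rates achievable with strong secrecy. -/
noncomputable def capacity (D : ℕ) (α : ℝ) : ℝ :=
  sSup {R : ℝ | Achievable D α R}

end CBC

namespace CBC

/-! ### Concentration for uniformly random functions -/

/-- The moment generating function of `∑ x ∈ Q, g (f x)` for a uniformly random function `f`. -/
theorem sum_exp_le {X B : Type*} [Fintype X] [DecidableEq X] [Fintype B] [Nonempty B]
    (Q : Finset X) (g : B → ℝ) (hg0 : ∀ b, 0 ≤ g b) (hg1 : ∀ b, g b ≤ 1)
    (t : ℝ) (ht : |t| ≤ 1) :
    ∑ f : X → B, Real.exp (t * ∑ x ∈ Q, g (f x)) ≤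
      (Fintype.card (X → B) : ℝ) *
        Real.exp ((t + t ^ 2) * (Q.card * (∑ b, g b) / Fintype.card B)) := by
  have hB : (0 : ℝ) < Fintype.card B := by exact_mod_cast Fintype.card_pos
  set G : ℝ := (∑ b, g b) / Fintype.card B with hG
  have hone : ∑ b, Real.exp (t * g b) ≤ Fintype.card B * Real.exp ((t + t ^ 2) * G) := by
    have h1 : ∀ b, Real.exp (t * g b) ≤ 1 + (t + t ^ 2) * g b := by
      intro b
      have habs : |t * g b| ≤ 1 := by
        rw [abs_mul, abs_of_nonneg (hg0 b)]
        nlinarith [hg0 b, hg1 b, abs_nonneg t]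
      have h2 := (abs_le.1 (Real.abs_exp_sub_one_sub_id_le habs)).2
      nlinarith [mul_nonneg (mul_nonneg (sq_nonneg t) (hg0 b)) (sub_nonneg.2 (hg1 b))]
    calc ∑ b, Real.exp (t * g b) ≤ ∑ b, (1 + (t + t ^ 2) * g b) :=
          Finset.sum_le_sum fun b _ => h1 b
      _ = Fintype.card B * ((t + t ^ 2) * G + 1) := by
          rw [Finset.sum_add_distrib, ← Finset.mul_sum, hG]
          simp
          field_simp
          ring
      _ ≤ _ := by gcongr; exact Real.add_one_le_exp _
  calc ∑ f : X → B, Real.exp (t * ∑ x ∈ Q, g (f x))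
      = ∑ f : X → B, ∏ x, (if x ∈ Q then Real.exp (t * g (f x)) else 1) := by
        refine Finset.sum_congr rfl fun f _ => ?_
        rw [Finset.prod_ite_mem, Finset.univ_inter, Finset.mul_sum, Real.exp_sum]
    _ = ∏ x, ∑ b : B, (if x ∈ Q then Real.exp (t * g b) else 1) := by
        rw [Finset.prod_univ_sum, Fintype.piFinset_univ]
    _ ≤ ∏ x : X, (Fintype.card B * (if x ∈ Q then Real.exp ((t + t ^ 2) * G) else 1) : ℝ) := by
        refine Finset.prod_le_prod (fun x _ => ?_) fun x _ => ?_
        · refine Finset.sum_nonneg fun b _ => ?_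
          split_ifs <;> positivity
        · split_ifs with h
          · exact hone
          · simp
    _ = _ := by
        rw [Finset.prod_mul_distrib, Finset.prod_ite_mem, Finset.univ_inter, Finset.prod_const,
          Finset.prod_const, ← Real.exp_nat_mul, Fintype.card_fun, Finset.card_univ, hG]
        push_cast
        congr 2
        ring

/-- Chernoff bound for `∑ x ∈ Q, g (f x)` with `f` a uniformly random function. -/
theorem card_deviation_le {X B : Type*} [Fintype X] [DecidableEq X] [Fintype B] [Nonempty B]
    (Q : Finset X) (g : B → ℝ) (hg0 : ∀ b, 0 ≤ g b) (hg1 : ∀ b, g b ≤ 1)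
    (δ T μ : ℝ) (hδ0 : 0 ≤ δ) (hδ1 : δ ≤ 1)
    (hμ : μ = Q.card * (∑ b, g b) / Fintype.card B) :
    ((Finset.univ.filter fun f : X → B =>
        δ * max μ T < |∑ x ∈ Q, g (f x) - μ|).card : ℝ) ≤
      (Fintype.card (X → B) : ℝ) * (2 * Real.exp (-(δ ^ 2 * T / 4))) := by
  have hμ0 : 0 ≤ μ := by
    rw [hμ]
    have := Finset.sum_nonneg fun b (_ : b ∈ Finset.univ) => hg0 b
    positivity
  set m := max μ T with hm
  have hμm : μ ≤ m := le_max_left _ _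
  have hTm : T ≤ m := le_max_right _ _
  set t := δ / 2 with ht
  set S : (X → B) → ℝ := fun f => ∑ x ∈ Q, g (f x) with hS
  have hup := sum_exp_le Q g hg0 hg1 t (by rw [abs_of_nonneg (by positivity)]; linarith)
  have hlo := sum_exp_le Q g hg0 hg1 (-t) (by
    rw [abs_neg, abs_of_nonneg (by positivity)]; linarith)
  rw [← hμ] at hup hlo
  have hpt : ∀ f : X → B, (if δ * m < |S f - μ| then (1 : ℝ) else 0) ≤
      Real.exp (t * S f) * Real.exp (-t * μ - t * (δ * m)) +
        Real.exp (-t * S f) * Real.exp (t * μ - t * (δ * m)) := by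
    intro f
    split_ifs with h
    · rw [← Real.exp_add, ← Real.exp_add]
      rcases lt_abs.1 h with h | h
      · have : 1 ≤ Real.exp (t * S f + (-t * μ - t * (δ * m))) :=
          Real.one_le_exp (by nlinarith)
        linarith [Real.exp_pos (-t * S f + (t * μ - t * (δ * m)))]
      · have : 1 ≤ Real.exp (-t * S f + (t * μ - t * (δ * m))) :=
          Real.one_le_exp (by nlinarith)
        linarith [Real.exp_pos (t * S f + (-t * μ - t * (δ * m)))]
    · positivity
  have hexp : t ^ 2 * μ - t * (δ * m) ≤ -(δ ^ 2 * T / 4) := by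
    rw [ht]
    nlinarith [mul_le_mul_of_nonneg_left hμm (sq_nonneg δ),
      mul_le_mul_of_nonneg_left hTm (sq_nonneg δ)]
  calc _ = ∑ f : X → B, (if δ * m < |S f - μ| then (1 : ℝ) else 0) := by
        rw [Finset.sum_boole]
    _ ≤ ∑ f : X → B, (Real.exp (t * S f) * Real.exp (-t * μ - t * (δ * m)) +
        Real.exp (-t * S f) * Real.exp (t * μ - t * (δ * m))) :=
        Finset.sum_le_sum fun f _ => hpt f
    _ = (∑ f : X → B, Real.exp (t * S f)) * Real.exp (-t * μ - t * (δ * m)) +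
        (∑ f : X → B, Real.exp (-t * S f)) * Real.exp (t * μ - t * (δ * m)) := by
        rw [Finset.sum_add_distrib, Finset.sum_mul, Finset.sum_mul]
    _ ≤ ((Fintype.card (X → B) : ℝ) * Real.exp ((t + t ^ 2) * μ)) *
          Real.exp (-t * μ - t * (δ * m)) +
        ((Fintype.card (X → B) : ℝ) * Real.exp ((-t + (-t) ^ 2) * μ)) *
          Real.exp (t * μ - t * (δ * m)) := by
        gcongr
    _ = (Fintype.card (X → B) : ℝ) * (2 * Real.exp (t ^ 2 * μ - t * (δ * m))) := by
        rw [mul_assoc, mul_assoc, ← Real.exp_add, ← Real.exp_add]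
        ring_nf
    _ ≤ _ := by gcongr

/-- If a family of sums is small enough, some function makes all of them concentrate at once. -/
theorem exists_fun_concentrated {X B J : Type*} [Fintype X] [DecidableEq X] [Fintype B]
    [Nonempty B] [Fintype J]
    (Q : J → Finset X) (g : J → B → ℝ) (hg0 : ∀ j b, 0 ≤ g j b) (hg1 : ∀ j b, g j b ≤ 1)
    (δ T : ℝ) (hδ0 : 0 ≤ δ) (hδ1 : δ ≤ 1)
    (hJ : (Fintype.card J : ℝ) * (2 * Real.exp (-(δ ^ 2 * T / 4))) < 1) :
    ∃ f : X → B, ∀ j, |∑ x ∈ Q j, g j (f x) - (Q j).card * (∑ b, g j b) / Fintype.card B| ≤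
      δ * max ((Q j).card * (∑ b, g j b) / Fintype.card B) T := by
  classical
  by_contra! hcon
  set bad : J → Finset (X → B) := fun j => Finset.univ.filter fun f : X → B =>
    δ * max ((Q j).card * (∑ b, g j b) / Fintype.card B) T <
      |∑ x ∈ Q j, g j (f x) - (Q j).card * (∑ b, g j b) / Fintype.card B| with hbad
  have hcover : (Finset.univ : Finset (X → B)) ⊆ Finset.univ.biUnion bad := by
    intro f _
    obtain ⟨j, hj⟩ := hcon f
    exact Finset.mem_biUnion.2 ⟨j, Finset.mem_univ _, by simpa [hbad] using hj⟩
  have hN : (0 : ℝ) < Fintype.card (X → B) := by exact_mod_cast Fintype.card_pos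
  have hle : (Fintype.card (X → B) : ℝ) ≤ ∑ j, ((bad j).card : ℝ) := by
    exact_mod_cast (Finset.card_le_card hcover).trans Finset.card_biUnion_le
  have hsum : ∑ j, ((bad j).card : ℝ) ≤
      ∑ _j : J, (Fintype.card (X → B) : ℝ) * (2 * Real.exp (-(δ ^ 2 * T / 4))) :=
    Finset.sum_le_sum fun j _ =>
      card_deviation_le (Q j) (g j) (hg0 j) (hg1 j) δ T _ hδ0 hδ1 rfl
  rw [Finset.sum_const, nsmul_eq_mul, Finset.card_univ] at hsum
  nlinarith

/-! ### Multiplicative closeness -/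

/-- The numbers `x` and `y` agree up to the multiplicative factor `r`. -/
def Near (r x y : ℝ) : Prop := x ≤ r * y ∧ y ≤ r * x

theorem Near.symm {r x y : ℝ} (h : Near r x y) : Near r y x := ⟨h.2, h.1⟩

theorem Near.mul {r s x y x' y' : ℝ} (hr : 0 ≤ r) (hx : 0 ≤ x) (hy : 0 ≤ y) (hx' : 0 ≤ x')
    (hy' : 0 ≤ y') (h : Near r x y) (h' : Near s x' y') : Near (r * s) (x * x') (y * y') := by
  constructor
  · calc x * x' ≤ (r * y) * (s * y') := mul_le_mul h.1 h'.1 hx' (by positivity)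
      _ = _ := by ring
  · calc y * y' ≤ (r * x) * (s * x') := mul_le_mul h.2 h'.2 hy' (by positivity)
      _ = _ := by ring

theorem Near.trans {r s x y z : ℝ} (hr : 0 ≤ r) (hs : 0 ≤ s) (h : Near r x y)
    (h' : Near s y z) : Near (r * s) x z := by
  constructor
  · calc x ≤ r * y := h.1
      _ ≤ r * (s * z) := mul_le_mul_of_nonneg_left h'.1 hr
      _ = _ := by ring
  · calc z ≤ s * y := h'.2
      _ ≤ s * (r * x) := mul_le_mul_of_nonneg_left h.2 hs
      _ = _ := by ring

theorem Near.const_mul {r x y c : ℝ} (hc : 0 ≤ c) (h : Near r x y) :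
    Near r (c * x) (c * y) := by
  constructor
  · calc c * x ≤ c * (r * y) := mul_le_mul_of_nonneg_left h.1 hc
      _ = _ := by ring
  · calc c * y ≤ c * (r * x) := mul_le_mul_of_nonneg_left h.2 hc
      _ = _ := by ring

theorem Near.inv {r x y : ℝ} (hx : 0 < x) (hy : 0 < y) (h : Near r x y) :
    Near r x⁻¹ y⁻¹ := by
  constructor
  · rw [← div_eq_mul_inv, le_div_iff₀ hy, inv_mul_le_iff₀ hx, mul_comm]
    exact h.2
  · rw [← div_eq_mul_inv, le_div_iff₀ hx, inv_mul_le_iff₀ hy, mul_comm]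
    exact h.1

theorem Near.sum {ι : Type*} {r : ℝ} {s : Finset ι} {x y : ι → ℝ}
    (h : ∀ i ∈ s, Near r (x i) (y i)) : Near r (∑ i ∈ s, x i) (∑ i ∈ s, y i) := by
  constructor
  · rw [Finset.mul_sum]; exact Finset.sum_le_sum fun i hi => (h i hi).1
  · rw [Finset.mul_sum]; exact Finset.sum_le_sum fun i hi => (h i hi).2

theorem near_of_abs_sub_le {δ x y : ℝ} (hδ0 : 0 ≤ δ) (hδ : δ ≤ 1 / 2) (hy : 0 ≤ y)
    (h : |x - y| ≤ δ * y) : Near (1 + 2 * δ) x y := by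
  obtain ⟨h1, h2⟩ := abs_le.1 h
  constructor
  · nlinarith
  · nlinarith [mul_nonneg (mul_nonneg hδ0 (by linarith : (0 : ℝ) ≤ 1 - 2 * δ)) hy]

/-! ### Balanced random encoders -/

/-- Concentration for the number of points of each `Q i` mapped to a given label. -/
theorem card_near_of_concentrated {X B : Type*} [DecidableEq B]
    (Q : Finset X) (f : X → B) (g : B → Prop) [DecidablePred g] (δ T μ : ℝ)
    (hδ0 : 0 ≤ δ) (hδ : δ ≤ 1 / 2) (hμ0 : 0 ≤ μ) (hμ : T ≤ μ)
    (h : |∑ x ∈ Q, (if g (f x) then (1 : ℝ) else 0) - μ| ≤ δ * max μ T) :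
    Near (1 + 2 * δ) ((Q.filter fun x => g (f x)).card : ℝ) μ := by
  rw [max_eq_left hμ, Finset.sum_boole] at h
  exact near_of_abs_sub_le hδ0 hδ hμ0 h

theorem sum_indicator_fst {P G : Type*} [Fintype P] [Fintype G] [DecidableEq P] (p : P) :
    ∑ b : P × G, (if b.1 = p then (1 : ℝ) else 0) = Fintype.card G := by
  rw [Fintype.sum_prod_type_right]
  simp

/-- Existence of a labelling whose fibres are balanced on every set of a family. -/
theorem exists_balanced_fun {X I P G : Type*} [Fintype X] [DecidableEq X] [Fintype I]
    [Fintype P] [DecidableEq P] [Nonempty P] [Fintype G] [DecidableEq G] [Nonempty G]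
    (Q : I → Finset X) (δ T : ℝ) (hδ0 : 0 ≤ δ) (hδ : δ ≤ 1 / 2) (hT : 1 ≤ T)
    (hcount : ((Fintype.card I * Fintype.card P + Fintype.card I * (Fintype.card P *
      Fintype.card G) : ℕ) : ℝ) * (2 * Real.exp (-(δ ^ 2 * T / 4))) < 1) :
    ∃ F : X → P × G,
      (∀ i p, (Fintype.card P = 1 ∨ Fintype.card P * T ≤ (Q i).card) →
        Near (1 + 2 * δ) (((Q i).filter fun x => (F x).1 = p).card : ℝ)
          ((Q i).card / Fintype.card P)) ∧
      (∀ i y, Fintype.card P * Fintype.card G * T ≤ (Q i).card →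
        Near (1 + 2 * δ) (((Q i).filter fun x => F x = y).card : ℝ)
          ((Q i).card / (Fintype.card P * Fintype.card G))) ∧
      (∀ i y, ((Q i).card : ℝ) ≤ Fintype.card P * Fintype.card G * T →
        (((Q i).filter fun x => F x = y).card : ℝ) ≤ 2 * T) := by
  have hP : (0 : ℝ) < Fintype.card P := by exact_mod_cast Fintype.card_pos
  have hG : (0 : ℝ) < Fintype.card G := by exact_mod_cast Fintype.card_pos
  obtain ⟨F, hF⟩ := exists_fun_concentrated (X := X) (B := P × G) (J := (I × P) ⊕ (I × (P × G)))
    (Sum.elim (fun j => Q j.1) fun j => Q j.1)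
    (Sum.elim (fun j b => if b.1 = j.2 then 1 else 0) fun j b => if b = j.2 then 1 else 0)
    (by rintro (j | j) b <;> simp only [Sum.elim_inl, Sum.elim_inr] <;> split_ifs <;> norm_num)
    (by rintro (j | j) b <;> simp only [Sum.elim_inl, Sum.elim_inr] <;> split_ifs <;> norm_num)
    δ T hδ0 (by linarith) (by simpa using hcount)
  have hsum2 : ∀ y : P × G, ∑ b : P × G, (if b = y then (1 : ℝ) else 0) = 1 := by
    intro y; simp
  have hF1 : ∀ i p, |∑ x ∈ Q i, (if (F x).1 = p then (1 : ℝ) else 0) -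
      (Q i).card / Fintype.card P| ≤ δ * max (((Q i).card : ℝ) / Fintype.card P) T := by
    intro i p
    have h := hF (Sum.inl (i, p))
    simp only [Sum.elim_inl] at h
    rw [sum_indicator_fst, Fintype.card_prod] at h
    push_cast at h
    rwa [mul_div_mul_right _ _ hG.ne'] at h
  have hF2 : ∀ i y, |∑ x ∈ Q i, (if F x = y then (1 : ℝ) else 0) -
      (Q i).card / (Fintype.card P * Fintype.card G)| ≤
        δ * max (((Q i).card : ℝ) / (Fintype.card P * Fintype.card G)) T := by
    intro i y
    have h := hF (Sum.inr (i, y))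
    simp only [Sum.elim_inr] at h
    rw [hsum2, Fintype.card_prod] at h
    push_cast at h
    rwa [mul_one] at h
  refine ⟨F, fun i p hi => ?_, fun i y hi => ?_, fun i y hi => ?_⟩
  · rcases hi with hi | hi
    · have : Subsingleton P := Fintype.card_le_one_iff_subsingleton.1 hi.le
      rw [Finset.filter_true_of_mem fun x _ => Subsingleton.elim _ _, hi]
      apply near_of_abs_sub_le hδ0 hδ (by positivity)
      simp
      positivity
    · exact card_near_of_concentrated (Q i) F (fun b => b.1 = p) δ T _ hδ0 hδ (by positivity)
        (by rw [le_div_iff₀ hP]; linarith) (hF1 i p)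
  · exact card_near_of_concentrated (Q i) F (fun b => b = y) δ T _ hδ0 hδ (by positivity)
      (by rw [le_div_iff₀ (by positivity)]; linarith) (hF2 i y)
  · have h := hF2 i y
    have hle : (Q i).card / (Fintype.card P * Fintype.card G : ℝ) ≤ T := by
      rw [div_le_iff₀ (by positivity)]; linarith
    rw [max_eq_right hle, Finset.sum_boole] at h
    nlinarith [(abs_le.1 h).2]

/-- Existence of a labelling `h` such that the `h`-sum with a fixed labelling `F` is balanced on
products of sets of a family, as long as the fibres of `F` are small. -/
theorem exists_balanced_sum {X I P G : Type*} [Fintype X] [DecidableEq X] [Fintype I]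
    [Fintype P] [DecidableEq P] [Nonempty P] [Fintype G] [DecidableEq G] [AddCommGroup G]
    (Q : I → Finset X) (F : X → P × G) (δ T : ℝ) (hδ0 : 0 ≤ δ) (hδ : δ ≤ 1 / 2) (hT : 1 ≤ T)
    (hcount : ((Fintype.card I * Fintype.card P + Fintype.card I * (Fintype.card I *
      (Fintype.card P * (Fintype.card P * Fintype.card G))) : ℕ) : ℝ) *
        (2 * Real.exp (-(δ ^ 2 * T / 4))) < 1) :
    ∃ h : X → P × G,
      (∀ i p, (Fintype.card P = 1 ∨ Fintype.card P * T ≤ (Q i).card) →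
        Near (1 + 2 * δ) (((Q i).filter fun x => (h x).1 = p).card : ℝ)
          ((Q i).card / Fintype.card P)) ∧
      (∀ i j p q g, (∀ y, (((Q j).filter fun x => F x = y).card : ℝ) ≤ 2 * T) →
        2 * T ^ 2 * (Fintype.card P * Fintype.card G) ≤
          (Q i).card * ((Q j).filter fun x => (F x).1 = q).card →
        Near (1 + 2 * δ)
          (∑ a ∈ (Q i).filter fun a => (h a).1 = p,
            (((Q j).filter fun b => F b = (q, g - (h a).2)).card : ℝ))
          ((Q i).card * ((Q j).filter fun x => (F x).1 = q).card /
            (Fintype.card P * Fintype.card G))) := by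
  have hP : (0 : ℝ) < Fintype.card P := by exact_mod_cast Fintype.card_pos
  have hG : (0 : ℝ) < Fintype.card G := by exact_mod_cast Fintype.card_pos
  have hT0 : (0 : ℝ) < T := by linarith
  set l : I → P × G → ℝ := fun j y => (((Q j).filter fun x => F x = y).card : ℝ) with hl
  have hl0 : ∀ j y, 0 ≤ l j y / (2 * T) := fun j y => by simp only [hl]; positivity
  obtain ⟨h, hh⟩ := exists_fun_concentrated (X := X) (B := P × G)
    (J := (I × P) ⊕ (I × I × P × P × G))
    (Sum.elim (fun j => Q j.1) fun j => Q j.1)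
    (Sum.elim (fun j b => if b.1 = j.2 then 1 else 0) fun j b =>
      if b.1 = j.2.2.1 then min (l j.2.1 (j.2.2.2.1, j.2.2.2.2 - b.2) / (2 * T)) 1 else 0)
    (by
      rintro (j | j) b <;> simp only [Sum.elim_inl, Sum.elim_inr] <;> split_ifs
      exacts [zero_le_one, le_rfl, le_min (hl0 _ _) zero_le_one, le_rfl])
    (by rintro (j | j) b <;> simp only [Sum.elim_inl, Sum.elim_inr] <;> split_ifs <;> norm_num)
    δ T hδ0 (by linarith) (by simpa using hcount)
  refine ⟨h, fun i p hi => ?_, fun i j p q g hj hij => ?_⟩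
  · rcases hi with hi | hi
    · have : Subsingleton P := Fintype.card_le_one_iff_subsingleton.1 hi.le
      rw [Finset.filter_true_of_mem fun x _ => Subsingleton.elim _ _, hi]
      apply near_of_abs_sub_le hδ0 hδ (by positivity)
      simp
      positivity
    · have h1 := hh (Sum.inl (i, p))
      simp only [Sum.elim_inl] at h1
      rw [sum_indicator_fst, Fintype.card_prod] at h1
      push_cast at h1
      rw [mul_div_mul_right _ _ hG.ne'] at h1
      exact card_near_of_concentrated (Q i) h (fun b => b.1 = p) δ T _ hδ0 hδ (by positivity)
        (by rw [le_div_iff₀ hP]; linarith) h1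
  · have h1 := hh (Sum.inr (i, j, p, q, g))
    simp only [Sum.elim_inr] at h1
    have hmin : ∀ y, min (l j y / (2 * T)) 1 = l j y / (2 * T) := fun y =>
      min_eq_left (by rw [div_le_one (by positivity)]; exact hj y)
    simp only [hmin] at h1
    set n : ℝ := (((Q j).filter fun x => (F x).1 = q).card : ℝ) with hn
    have hn_sum : ∑ κ : G, l j (q, κ) = n := by
      rw [hn, Finset.card_eq_sum_card_fiberwise (f := fun x => (F x).2) (t := Finset.univ)
        (fun _ _ => Finset.mem_coe.2 (Finset.mem_univ _))]
      push_cast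
      refine Finset.sum_congr rfl fun κ _ => ?_
      simp only [hl, Finset.filter_filter, Prod.ext_iff]
    have hsum : ∑ b : P × G, (if b.1 = p then l j (q, g - b.2) / (2 * T) else 0) =
        n / (2 * T) := by
      rw [Fintype.sum_prod_type_right]
      simp only [Finset.sum_ite_eq', Finset.mem_univ, if_true]
      rw [← Finset.sum_div, ← hn_sum]
      congr 1
      exact (Equiv.subLeft g).sum_comp fun κ => l j (q, κ)
    rw [hsum, Fintype.card_prod] at h1
    push_cast at h1
    have hTle : T ≤ (Q i).card * (n / (2 * T)) / (Fintype.card P * Fintype.card G) := by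
      rw [le_div_iff₀ (by positivity), mul_div_assoc', le_div_iff₀ (by positivity)]
      nlinarith
    rw [max_eq_left hTle] at h1
    have h2 := (near_of_abs_sub_le hδ0 hδ (by linarith) h1).const_mul
      (c := 2 * T) (by positivity)
    rw [← Finset.sum_filter, ← Finset.sum_div, mul_div_cancel₀ _ (by positivity)] at h2
    convert h2 using 1
    field_simp

/-- Existence of two labellings that are balanced on every set of a family and whose sum is
balanced on products of these sets. -/
theorem exists_balanced_pair {X I P G : Type*} [Fintype X] [DecidableEq X] [Fintype I]
    [Fintype P] [DecidableEq P] [Nonempty P] [Fintype G] [DecidableEq G] [AddCommGroup G]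
    (Q : I → Finset X) (δ T : ℝ) (hδ0 : 0 ≤ δ) (hδ : δ ≤ 1 / 2) (hT : 1 ≤ T)
    (hcount : ((Fintype.card I * Fintype.card P + Fintype.card I * (Fintype.card P *
      Fintype.card G) : ℕ) : ℝ) * (2 * Real.exp (-(δ ^ 2 * T / 4))) < 1)
    (hcount' : ((Fintype.card I * Fintype.card P + Fintype.card I * (Fintype.card I *
      (Fintype.card P * (Fintype.card P * Fintype.card G))) : ℕ) : ℝ) *
        (2 * Real.exp (-(δ ^ 2 * T / 4))) < 1) :
    ∃ h F : X → P × G,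
      (∀ i p, (Fintype.card P = 1 ∨ Fintype.card P * T ≤ (Q i).card) →
        Near (1 + 2 * δ) (((Q i).filter fun x => (h x).1 = p).card : ℝ)
          ((Q i).card / Fintype.card P)) ∧
      (∀ i y, Fintype.card P * Fintype.card G * T ≤ (Q i).card →
        Near (1 + 2 * δ) (((Q i).filter fun x => F x = y).card : ℝ)
          ((Q i).card / (Fintype.card P * Fintype.card G))) ∧
      (∀ i j p q g, (Fintype.card P = 1 ∨ Fintype.card P * T ≤ (Q i).card) →
        (Fintype.card P = 1 ∨ Fintype.card P * T ≤ (Q j).card) →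
        4 * T ^ 2 * (Fintype.card P ^ 2 * Fintype.card G) ≤ ((Q i).card : ℝ) * (Q j).card →
        Near ((1 + 2 * δ) * (1 + 2 * δ))
          (∑ a ∈ (Q i).filter fun a => (h a).1 = p,
            (((Q j).filter fun b => F b = (q, g - (h a).2)).card : ℝ))
          ((Q i).card * (Q j).card / (Fintype.card P ^ 2 * Fintype.card G))) := by
  have hP : (0 : ℝ) < Fintype.card P := by exact_mod_cast Fintype.card_pos
  have hG : (0 : ℝ) < Fintype.card G := by exact_mod_cast Fintype.card_pos
  obtain ⟨F, hF1, hF2, hF3⟩ := exists_balanced_fun (P := P) (G := G) Q δ T hδ0 hδ hT hcount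
  obtain ⟨h, hh1, hh2⟩ := exists_balanced_sum (P := P) (G := G) Q F δ T hδ0 hδ hT hcount'
  refine ⟨h, F, hh1, hF2, fun i j p q g hi hj hij => ?_⟩
  have hr : (0 : ℝ) ≤ 1 + 2 * δ := by linarith
  rcases le_total (((Q j).card : ℝ)) (Fintype.card P * Fintype.card G * T) with hc | hc
  · have hn := hF1 j q hj
    refine (hh2 i j p q g (fun y => hF3 j y hc) ?_).trans hr hr ?_
    · have h1 : ((Q j).card : ℝ) ≤
          2 * Fintype.card P * ((Q j).filter fun x => (F x).1 = q).card := by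
        have := hn.2
        rw [div_le_iff₀ hP] at this
        refine this.trans ?_
        have h0 : (0 : ℝ) ≤ ((Q j).filter fun x => (F x).1 = q).card * Fintype.card P := by
          positivity
        nlinarith
      have h2 := mul_le_mul_of_nonneg_left h1 (Nat.cast_nonneg (Q i).card : (0 : ℝ) ≤ _)
      refine le_of_mul_le_mul_left ?_ (by positivity : (0 : ℝ) < 2 * Fintype.card P)
      nlinarith
    · convert hn.const_mul (c := (Q i).card / (Fintype.card P * Fintype.card G))
        (by positivity) using 1
      · ring
      · field_simp
  · have h1 : Near (1 + 2 * δ)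
        (∑ a ∈ (Q i).filter fun a => (h a).1 = p,
          (((Q j).filter fun b => F b = (q, g - (h a).2)).card : ℝ))
        (∑ a ∈ (Q i).filter fun a => (h a).1 = p,
          ((Q j).card / (Fintype.card P * Fintype.card G) : ℝ)) :=
      Near.sum fun a _ => hF2 j _ hc
    refine h1.trans hr hr ?_
    rw [Finset.sum_const, nsmul_eq_mul]
    convert (hh1 i p hi).const_mul (c := (Q j).card / (Fintype.card P * Fintype.card G))
      (by positivity) using 1
    · ring
    · field_simp

/-! ### Mutual information -/

theorem dist_nonneg {Ω A : Type*} [Fintype Ω] [DecidableEq A] {P : Ω → ℝ}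
    (hP : ∀ ω, 0 ≤ P ω) (X : Ω → A) (a : A) : 0 ≤ dist P X a :=
  Finset.sum_nonneg fun ω _ => by split_ifs <;> [exact hP ω; exact le_rfl]

theorem sum_dist {Ω A : Type*} [Fintype Ω] [Fintype A] [DecidableEq A]
    (P : Ω → ℝ) (X : Ω → A) : ∑ a, dist P X a = ∑ ω, P ω := by
  simp only [dist]
  rw [Finset.sum_comm]
  simp

theorem sum_dist_prod_left {Ω A B : Type*} [Fintype Ω] [Fintype A] [DecidableEq A]
    [DecidableEq B] (P : Ω → ℝ) (X : Ω → A) (Y : Ω → B) (b : B) :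
    ∑ a, dist P (fun ω => (X ω, Y ω)) (a, b) = dist P Y b := by
  simp only [dist, Prod.mk.injEq, ite_and]
  rw [Finset.sum_comm]
  simp

theorem sum_dist_prod_right {Ω A B : Type*} [Fintype Ω] [Fintype B] [DecidableEq A]
    [DecidableEq B] (P : Ω → ℝ) (X : Ω → A) (Y : Ω → B) (a : A) :
    ∑ b, dist P (fun ω => (X ω, Y ω)) (a, b) = dist P X a := by
  simp only [dist, Prod.mk.injEq, and_comm (b := Y _ = _), ite_and]
  rw [Finset.sum_comm]
  simp

theorem abs_mutInfo_le {Ω A B : Type*} [Fintype Ω] [Fintype A] [Fintype B]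
    [DecidableEq A] [DecidableEq B] {P : Ω → ℝ} {X : Ω → A} {Y : Ω → B}
    (hP : ∀ ω, 0 ≤ P ω) (hP1 : ∑ ω, P ω = 1) (κ : B → ℝ) {r : ℝ} (hr : 1 ≤ r)
    (h : ∀ a b, Near r (dist P (fun ω => (X ω, Y ω)) (a, b)) (dist P X a * κ b)) :
    |mutInfo P X Y| ≤ 2 * Real.log r := by
  have hr0 : 0 < r := by linarith
  have hY : ∀ b, Near r (κ b) (dist P Y b) := by
    intro b
    have h1 := Near.sum fun a (_ : a ∈ Finset.univ) => h a b
    rw [sum_dist_prod_left, ← Finset.sum_mul, sum_dist, hP1, one_mul] at h1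
    exact h1.symm
  have hXY : ∀ a b, Near (r * r) (dist P (fun ω => (X ω, Y ω)) (a, b))
      (dist P X a * dist P Y b) := fun a b =>
    (h a b).trans hr0.le hr0.le ((hY b).const_mul (dist_nonneg hP X a))
  have hterm : ∀ a b, |dist P (fun ω => (X ω, Y ω)) (a, b) *
      Real.log (dist P (fun ω => (X ω, Y ω)) (a, b) / (dist P X a * dist P Y b))| ≤
      dist P (fun ω => (X ω, Y ω)) (a, b) * (2 * Real.log r) := by
    intro a b
    have h0 := dist_nonneg hP (fun ω => (X ω, Y ω)) (a, b)
    obtain ⟨h1, h2⟩ := hXY a b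
    set p := dist P (fun ω => (X ω, Y ω)) (a, b)
    set q := dist P X a * dist P Y b
    rcases h0.eq_or_lt with h0 | h0
    · simp [← h0]
    · have hq : 0 < q := by
        by_contra! hq
        nlinarith [mul_nonneg (mul_nonneg hr0.le hr0.le) (neg_nonneg.2 hq)]
      rw [abs_mul, abs_of_pos h0]
      refine mul_le_mul_of_nonneg_left ?_ h0.le
      have hlog : 2 * Real.log r = Real.log (r * r) := by
        rw [Real.log_mul hr0.ne' hr0.ne']; ring
      rw [hlog, abs_le, ← Real.log_inv]
      constructor
      · refine Real.log_le_log (by positivity) ?_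
        rw [le_div_iff₀ hq, inv_mul_le_iff₀ (by positivity)]
        exact h2
      · refine Real.log_le_log (by positivity) ?_
        rw [div_le_iff₀ hq]
        exact h1
  calc |mutInfo P X Y| ≤ ∑ a, ∑ b, |dist P (fun ω => (X ω, Y ω)) (a, b) *
      Real.log (dist P (fun ω => (X ω, Y ω)) (a, b) / (dist P X a * dist P Y b))| :=
        (Finset.abs_sum_le_sum_abs _ _).trans
          (Finset.sum_le_sum fun a _ => Finset.abs_sum_le_sum_abs _ _)
    _ ≤ ∑ a, ∑ b, dist P (fun ω => (X ω, Y ω)) (a, b) * (2 * Real.log r) :=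
        Finset.sum_le_sum fun a _ => Finset.sum_le_sum fun b _ => hterm a b
    _ = 2 * Real.log r := by
        simp only [← Finset.sum_mul, sum_dist_prod_right]
        rw [sum_dist, hP1, one_mul]

/-- A variational lower bound on mutual information. -/
theorem sub_two_mul_le_mutInfo {Ω A B : Type*} [Fintype Ω] [Fintype A] [Fintype B]
    [DecidableEq A] [DecidableEq B] {P : Ω → ℝ} {X : Ω → A} {Y : Ω → B}
    (hP : ∀ ω, 0 ≤ P ω) (hP1 : ∑ ω, P ω = 1) (E : Finset (A × B)) :
    ∑ x ∈ E, dist P (fun ω => (X ω, Y ω)) x - 2 * ∑ x ∈ E, dist P X x.1 * dist P Y x.2 ≤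
      mutInfo P X Y := by
  have hterm : ∀ x : A × B,
      dist P (fun ω => (X ω, Y ω)) x - dist P X x.1 * dist P Y x.2 +
        (if x ∈ E then dist P (fun ω => (X ω, Y ω)) x -
          2 * (dist P X x.1 * dist P Y x.2) else 0) ≤
      dist P (fun ω => (X ω, Y ω)) x *
        Real.log (dist P (fun ω => (X ω, Y ω)) x / (dist P X x.1 * dist P Y x.2)) := by
    rintro ⟨a, b⟩
    have h0 := dist_nonneg hP (fun ω => (X ω, Y ω)) (a, b)
    have hX := dist_nonneg hP X a
    have hY := dist_nonneg hP Y b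
    have hpX : dist P (fun ω => (X ω, Y ω)) (a, b) ≤ dist P X a := by
      rw [← sum_dist_prod_right P X Y a]
      exact Finset.single_le_sum
        (f := fun b => dist P (fun ω => (X ω, Y ω)) (a, b))
        (fun b _ => dist_nonneg hP _ _) (Finset.mem_univ b)
    have hpY : dist P (fun ω => (X ω, Y ω)) (a, b) ≤ dist P Y b := by
      rw [← sum_dist_prod_left P X Y b]
      exact Finset.single_le_sum
        (f := fun a => dist P (fun ω => (X ω, Y ω)) (a, b))
        (fun a _ => dist_nonneg hP _ _) (Finset.mem_univ a)
    set p := dist P (fun ω => (X ω, Y ω)) (a, b)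
    have hq0 : 0 ≤ dist P X a * dist P Y b := mul_nonneg hX hY
    rcases h0.eq_or_lt with h0 | h0
    · rw [← h0]
      dsimp only
      split_ifs <;> simp <;> linarith
    · have hq : 0 < dist P X a * dist P Y b := mul_pos (h0.trans_le hpX) (h0.trans_le hpY)
      dsimp only
      set q := dist P X a * dist P Y b
      have hdiv : p * (q / p) = q := by field_simp
      have hlog : Real.log (p / q) = -Real.log (q / p) := by
        rw [← Real.log_inv, inv_div]
      rw [hlog]
      split_ifs
      · have h1 := Real.log_le_sub_one_of_pos (x := q / p * Real.exp 1) (by positivity)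
        rw [Real.log_mul (by positivity) (by positivity), Real.log_exp] at h1
        have h2 := mul_le_mul_of_nonneg_left h1 h0.le
        have h3 : p * (q / p * Real.exp 1 - 1) = q * Real.exp 1 - p := by
          rw [mul_sub, ← mul_assoc, hdiv, mul_one]
        have h4 := Real.exp_one_lt_d9
        nlinarith
      · have h1 := Real.log_le_sub_one_of_pos (x := q / p) (by positivity)
        have h2 := mul_le_mul_of_nonneg_left h1 h0.le
        rw [mul_sub, hdiv] at h2
        linarith
  have hsum := Finset.sum_le_sum fun x (_ : x ∈ Finset.univ) => hterm x
  rw [Finset.sum_add_distrib, Finset.sum_sub_distrib, sum_dist, hP1, Finset.sum_ite_mem,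
    Finset.univ_inter, Finset.sum_sub_distrib, ← Finset.mul_sum,
    Fintype.sum_prod_type (f := fun x => dist P X x.1 * dist P Y x.2)] at hsum
  simp only [← Finset.mul_sum, sum_dist, hP1, mul_one] at hsum
  rw [mutInfo, ← Fintype.sum_prod_type (f := fun x : A × B =>
    dist P (fun ω => (X ω, Y ω)) x *
      Real.log (dist P (fun ω => (X ω, Y ω)) x / (dist P X x.1 * dist P Y x.2)))]
  linarith

/-! ### Codes -/

theorem Code.P_nonneg {D n M C : ℕ} (c : Code D n M C)
    (ω : (Fin D → Fin M) × Fin (c.nr + 1)) : 0 ≤ c.P ω :=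
  mul_nonneg (by positivity) (c.q_nonneg _)

theorem Code.sum_P {D n M C : ℕ} (c : Code D n M C) (hM : 0 < M) : ∑ ω, c.P ω = 1 := by
  have : (M : ℝ) ≠ 0 := by positivity
  rw [Fintype.sum_prod_type]
  simp [Code.P, ← Finset.mul_sum, c.q_sum, this]

theorem Code.dist_message {D n M C : ℕ} (c : Code D n M C) (w : Fin D → Fin M) :
    dist c.P (fun ω => ω.1) w = 1 / (M : ℝ) ^ D := by
  simp only [dist, Fintype.sum_prod_type, Code.P]
  rw [Finset.sum_eq_single w (fun v _ hv => by simp [hv]) (by simp)]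
  simp [← Finset.mul_sum, c.q_sum]

theorem Code.abs_leak_le {D n M C : ℕ} (c : Code D n M C) (hM : 0 < M) (d : Fin D × Fin D)
    (S1 S2 : Finset (Fin n)) (κ : (Fin n → Option Bool) × (Fin n → Option Bool) → ℝ)
    {r : ℝ} (hr : 1 ≤ r)
    (h : ∀ w z, Near r
      (∑ θ, if (tap S1 (c.encC w θ), tap S2 (c.encD d w θ)) = z then c.q θ else 0) (κ z)) :
    |c.leak d S1 S2| ≤ 2 * Real.log r := by
  refine abs_mutInfo_le c.P_nonneg (c.sum_P hM) κ hr fun w z => ?_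
  rw [c.dist_message]
  convert (h w z).const_mul (c := 1 / (M : ℝ) ^ D) (by positivity) using 1
  simp only [dist, Fintype.sum_prod_type, Code.P]
  rw [Finset.sum_eq_single w (fun v _ hv => by simp [hv]) (by simp), Finset.mul_sum]
  refine Finset.sum_congr rfl fun θ _ => ?_
  by_cases hz : (tap S1 (c.encC w θ), tap S2 (c.encD d w θ)) = z <;> simp [hz]

/-! ### Stochastic encoding by uniform selectors -/

/-- A simultaneous choice of an element from every nonempty finite set. -/
abbrev Selector (X : Type*) := ∀ s : {s : Finset X // s.Nonempty}, s.1

theorem sum_selector {X : Type*} [Fintype X] [DecidableEq X] (s : {s : Finset X // s.Nonempty})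
    (f : X → ℝ) :
    (∑ θ : Selector X, f (θ s)) / Fintype.card (Selector X) = (∑ x ∈ s.1, f x) / s.1.card := by
  have hs : (s.1.card : ℝ) ≠ 0 := by exact_mod_cast s.2.card_ne_zero
  let e := Equiv.piSplitAt s fun t : {s : Finset X // s.Nonempty} => t.1
  have : ∀ t : {s : Finset X // s.Nonempty}, Nonempty t.1 := fun t => t.2.to_subtype
  have hR : (Fintype.card (∀ t : {t // t ≠ s}, t.1.1) : ℝ) ≠ 0 := by
    exact_mod_cast Fintype.card_ne_zero
  have hcard : (Fintype.card (Selector X) : ℝ) =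
      s.1.card * Fintype.card (∀ t : {t // t ≠ s}, t.1.1) := by
    rw [Fintype.card_congr e, Fintype.card_prod, Fintype.card_coe]
    push_cast
    rfl
  have hsum : ∑ θ : Selector X, f (θ s) =
      (∑ x ∈ s.1, f x) * Fintype.card (∀ t : {t // t ≠ s}, t.1.1) := by
    rw [← Equiv.sum_comp e.symm, Fintype.sum_prod_type, ← Finset.sum_coe_sort s.1 f,
      Finset.sum_mul]
    refine Finset.sum_congr rfl fun x _ => ?_
    have : ∀ y, e.symm (x, y) s = x := fun y => by simp [e, Equiv.piSplitAt]
    simp [this, mul_comm]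
  rw [hcard, hsum]
  field_simp

theorem sum_selector_prod {X : Type*} [Fintype X] [DecidableEq X]
    (s : {s : Finset X // s.Nonempty}) (t : X → {s : Finset X // s.Nonempty}) (f : X → X → ℝ) :
    (∑ θ : Selector X × Selector X, f (θ.1 s) (θ.2 (t (θ.1 s)))) /
        Fintype.card (Selector X × Selector X) =
      (∑ x ∈ s.1, (∑ y ∈ (t x).1, f x y) / (t x).1.card) / s.1.card := by
  rw [← sum_selector s fun x => (∑ y ∈ (t x).1, f x y) / (t x).1.card, Fintype.sum_prod_type]
  simp only [← sum_selector]
  rw [← Finset.sum_div, div_div, Fintype.card_prod]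
  push_cast
  rw [mul_comm]

/-! ### The coding scheme -/

/-- The content of the two caches: the sum of the first two parts of the two files. -/
def cacheLabel {A B : Type*} [Add A] (u : Fin 2 → A × A × B) : A × A :=
  ((u 0).1 + (u 1).1, (u 0).2.1 + (u 1).2.1)

/-- The unencrypted content of the delivery transmission. -/
def deliveryLabel {A B : Type*} (d : Fin 2 × Fin 2) (u : Fin 2 → A × A × B) : A × A :=
  if d.1 = d.2 then ((u d.1).1, (u d.1).2.1) else ((u d.2).1, (u d.1).2.1)

/-- Recovery of the first two parts of the requested file from a cache and the delivery. -/
def recoverLabel {A : Type*} [Sub A] (d : Fin 2 × Fin 2) (j : Fin 2) (p : A) (q : A × A) :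
    A × A :=
  if d.1 = d.2 then q else if j = 0 then (p - q.1, q.2) else (q.1, p - q.2)

theorem recoverLabel_zero {A B : Type*} [AddCommGroup A] (d : Fin 2 × Fin 2)
    (u : Fin 2 → A × A × B) :
    recoverLabel d 0 (cacheLabel u).1 (deliveryLabel d u) = ((u d.1).1, (u d.1).2.1) := by
  obtain ⟨d1, d2⟩ := d
  fin_cases d1 <;> fin_cases d2 <;> simp [recoverLabel, cacheLabel, deliveryLabel]

theorem recoverLabel_one {A B : Type*} [AddCommGroup A] (d : Fin 2 × Fin 2)
    (u : Fin 2 → A × A × B) :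
    recoverLabel d 1 (cacheLabel u).2 (deliveryLabel d u) = ((u d.2).1, (u d.2).2.1) := by
  obtain ⟨d1, d2⟩ := d
  fin_cases d1 <;> fin_cases d2 <;> simp [recoverLabel, cacheLabel, deliveryLabel]

/-- The delivered word for demand `d` when `x` was sent in the placement phase is drawn from
this fibre of `F`: the third parts of the requested files are masked by keys from `h x`. -/
def deliveryTarget {X A B : Type*} [Sub B] (h : X → (A × A) × B × B) (d : Fin 2 × Fin 2)
    (u : Fin 2 → A × A × B) (x : X) : (A × A) × B × B :=
  (deliveryLabel d u, ((u d.1).2.2, (u d.2).2.2) - (h x).2)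

/-- The code built from labellings `h` of placement words and `F` of delivery words. -/
theorem exists_code_of_labels {n M C : ℕ} {A B : Type*} [Fintype A] [Fintype B]
    [DecidableEq A] [DecidableEq B] [AddCommGroup A] [AddCommGroup B] (hM : 0 < M)
    (hC : Fintype.card A * Fintype.card B ≤ C)
    (hMAB : M ≤ Fintype.card A * (Fintype.card A * Fintype.card B))
    (h F : (Fin n → Bool) → (A × A) × B × B)
    (hh : ∀ p, (Finset.univ.filter fun x => (h x).1 = p).Nonempty)
    (hF : ∀ y, (Finset.univ.filter fun x => F x = y).Nonempty) :
    ∃ c : Code 2 n M C, (∀ d, c.errProb d = 0) ∧ ∀ d S1 S2 w z, ∃ p q g,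
      (∑ θ, if (tap S1 (c.encC w θ), tap S2 (c.encD d w θ)) = z then c.q θ else 0) =
        ∑ x ∈ (Finset.univ.filter fun x => tap S1 x = z.1).filter fun x => (h x).1 = p,
          (((Finset.univ.filter fun x => tap S2 x = z.2).filter fun y =>
              F y = (q, g - (h x).2)).card : ℝ) *
            (((Finset.univ.filter fun y => F y = (q, g - (h x).2)).card : ℝ)⁻¹ *
              ((Finset.univ.filter fun x => (h x).1 = p).card : ℝ)⁻¹) := by
  classical
  obtain ⟨ι⟩ : Nonempty (Fin M ↪ A × A × B) :=
    Function.Embedding.nonempty_of_card_le (by simpa [Fintype.card_prod] using hMAB)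
  obtain ⟨κ⟩ : Nonempty (A × B ↪ Fin C) :=
    Function.Embedding.nonempty_of_card_le (by simpa [Fintype.card_prod] using hC)
  have : Nonempty (Fin M) := ⟨⟨0, hM⟩⟩
  let X := Fin n → Bool
  have : ∀ t : {s : Finset X // s.Nonempty}, Nonempty t.1 := fun t => t.2.to_subtype
  let Θ := Selector X × Selector X
  have hΘ : Fintype.card Θ - 1 + 1 = Fintype.card Θ :=
    Nat.sub_add_cancel Fintype.card_pos
  let e : Fin (Fintype.card Θ - 1 + 1) ≃ Θ :=
    (finCongr hΘ).trans (Fintype.equivFin Θ).symm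
  let u : (Fin 2 → Fin M) → Fin 2 → A × A × B := fun w i => ι (w i)
  let sC : (Fin 2 → Fin M) → {s : Finset X // s.Nonempty} := fun w =>
    ⟨_, hh (cacheLabel (u w))⟩
  let sD : Fin 2 × Fin 2 → (Fin 2 → Fin M) → X → {s : Finset X // s.Nonempty} := fun d w x =>
    ⟨_, hF (deliveryTarget h d (u w) x)⟩
  let read : Fin 2 × Fin 2 → Fin 2 → A × B → X → A × A × B := fun d j m y =>
    ((recoverLabel d j m.1 (F y).1).1, (recoverLabel d j m.1 (F y).1).2,
      (if j = 0 then (F y).2.1 else (F y).2.2) + m.2)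
  let c : Code 2 n M C :=
    { nr := Fintype.card Θ - 1
      q := fun _ => (Fintype.card Θ : ℝ)⁻¹
      q_nonneg := fun _ => by positivity
      q_sum := by
        rw [Finset.sum_const, Finset.card_univ, Fintype.card_fin, hΘ, nsmul_eq_mul]
        exact mul_inv_cancel₀ (by exact_mod_cast Fintype.card_ne_zero)
      encC := fun w θ => (e θ).1 (sC w)
      cacheF := fun j x => κ (if j = 0 then ((h x).1.1, (h x).2.1) else ((h x).1.2, (h x).2.2))
      encD := fun d w θ => (e θ).2 (sD d w ((e θ).1 (sC w)))
      dec := fun d j m y => Function.invFun ι (read d j (Function.invFun κ m) y) }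
  have hencC : ∀ w θ, (h (c.encC w θ)).1 = cacheLabel (u w) := fun w θ =>
    (Finset.mem_filter.1 ((e θ).1 (sC w)).2).2
  have hencD : ∀ d w θ, F (c.encD d w θ) = deliveryTarget h d (u w) (c.encC w θ) :=
    fun d w θ => (Finset.mem_filter.1 ((e θ).2 (sD d w ((e θ).1 (sC w)))).2).2
  refine ⟨c, fun d => ?_, fun d S1 S2 w z => ?_⟩
  · refine Finset.sum_eq_zero fun ω _ => if_neg ?_
    obtain ⟨w, θ⟩ := ω
    push Not
    have h0 : c.dec d 0 (c.cacheF 0 (c.encC w θ)) (c.encD d w θ) = w d.1 := by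
      have hread : read d 0 ((h (c.encC w θ)).1.1, (h (c.encC w θ)).2.1) (c.encD d w θ) =
          ι (w d.1) := by
        simp only [read, hencD, hencC, deliveryTarget, recoverLabel_zero]
        simp [u]
      change Function.invFun ι (read d 0 (Function.invFun κ (κ _)) _) = _
      rw [Function.leftInverse_invFun κ.injective]
      simp only [if_true, hread]
      exact Function.leftInverse_invFun ι.injective _
    have h1 : c.dec d 1 (c.cacheF 1 (c.encC w θ)) (c.encD d w θ) = w d.2 := by
      have hread : read d 1 ((h (c.encC w θ)).1.2, (h (c.encC w θ)).2.2) (c.encD d w θ) =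
          ι (w d.2) := by
        simp only [read, hencD, hencC, deliveryTarget, recoverLabel_one]
        simp [u]
      change Function.invFun ι (read d 1 (Function.invFun κ (κ _)) _) = _
      rw [Function.leftInverse_invFun κ.injective]
      simp only [one_ne_zero, if_false, hread]
      exact Function.leftInverse_invFun ι.injective _
    exact ⟨h0, h1⟩
  · refine ⟨cacheLabel (u w), deliveryLabel d (u w), ((u w d.1).2.2, (u w d.2).2.2), ?_⟩
    have hsel := sum_selector_prod (sC w) (sD d w)
      fun x y => if (tap S1 x, tap S2 y) = z then (1 : ℝ) else 0
    have hlhs : (∑ θ, if (tap S1 (c.encC w θ), tap S2 (c.encD d w θ)) = z then c.q θ else 0) =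
        (∑ θ : Θ, if (tap S1 (θ.1 (sC w) : X), tap S2 (θ.2 (sD d w (θ.1 (sC w))) : X)) = z
          then (1 : ℝ) else 0) / Fintype.card Θ := by
      rw [← Equiv.sum_comp e, Finset.sum_div]
      refine Finset.sum_congr rfl fun θ _ => ?_
      rw [ite_div, one_div, zero_div]
    rw [hlhs]
    refine hsel.trans ?_
    rw [Finset.filter_comm, Finset.sum_div]
    refine Eq.trans ?_ (Finset.sum_filter _ _).symm
    refine Finset.sum_congr rfl fun x _ => ?_
    by_cases hx : tap S1 x = z.1
    · rw [if_pos hx]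
      have hz : ∀ y, ((tap S1 x, tap S2 y) = z) = (tap S2 y = z.2) := fun y => by
        rw [Prod.ext_iff]; simp [hx]
      simp only [hz, Finset.sum_boole]
      rw [Finset.filter_comm, div_div, div_eq_mul_inv, mul_inv]
      rfl
    · have hz : ∀ y, ¬ (tap S1 x, tap S2 y) = z := fun y hy => hx (congrArg Prod.fst hy)
      simp [hz, hx]

/-! ### Tapped subcubes -/

theorem tap_eq_tap_iff {n : ℕ} {S : Finset (Fin n)} {x y : Fin n → Bool} :
    tap S x = tap S y ↔ ∀ i ∈ S, x i = y i := by
  simp only [tap, funext_iff]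
  refine forall_congr' fun i => ?_
  by_cases hi : i ∈ S <;> simp [hi]

theorem card_tap_eq_tap {n : ℕ} (S : Finset (Fin n)) (y : Fin n → Bool) :
    (Finset.univ.filter fun x => tap S x = tap S y).card = 2 ^ (n - S.card) := by
  have : (Finset.univ.filter fun x => tap S x = tap S y) =
      Fintype.piFinset fun i => if i ∈ S then {y i} else Finset.univ := by
    ext x
    simp only [Finset.mem_filter, Finset.mem_univ, true_and, tap_eq_tap_iff,
      Fintype.mem_piFinset]
    refine forall_congr' fun i => ?_
    by_cases hi : i ∈ S <;> simp [hi]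
  rw [this, Fintype.card_piFinset]
  have hcard : ∀ i, (if i ∈ S then {y i} else (Finset.univ : Finset Bool)).card =
      if i ∈ Sᶜ then 2 else 1 := by
    intro i
    by_cases hi : i ∈ S <;> simp [hi]
  rw [Finset.prod_congr rfl fun i _ => hcard i, Finset.prod_ite_mem, Finset.univ_inter,
    Finset.prod_const, Finset.card_compl, Fintype.card_fin]

theorem card_tap_eq_le {n : ℕ} (S : Finset (Fin n)) (z : Fin n → Option Bool) :
    (Finset.univ.filter fun x => tap S x = z).card ≤ 2 ^ (n - S.card) := by
  by_cases hz : ∃ y, tap S y = z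
  · obtain ⟨y, rfl⟩ := hz
    exact (card_tap_eq_tap S y).le
  · rw [Finset.filter_false_of_mem fun x _ hx => hz ⟨x, hx⟩]
    simp

/-! ### Secure codes -/

theorem exists_secure_code {n M C : ℕ} {A B : Type*} [Fintype A] [Fintype B]
    [DecidableEq A] [DecidableEq B] [AddCommGroup A] [AddCommGroup B] (hM : 0 < M)
    (hC : Fintype.card A * Fintype.card B ≤ C)
    (hMAB : M ≤ Fintype.card A * (Fintype.card A * Fintype.card B))
    {α δ T : ℝ} (hδ0 : 0 ≤ δ) (hδ : δ ≤ 1 / 2) (hT : 1 ≤ T)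
    (hcount : 4 * 64 ^ n * Real.exp (-(δ ^ 2 * T / 4)) < 1)
    (hsize : Fintype.card (A × A) * Fintype.card (B × B) * T ≤ (2 : ℝ) ^ n)
    (hwide : Fintype.card (A × A) = 1 ∨ ∀ S : Finset (Fin n), (S.card : ℝ) ≤ α * n →
      Fintype.card (A × A) * T ≤ (2 : ℝ) ^ (n - S.card))
    (hpair : ∀ S1 S2 : Finset (Fin n), (S1.card : ℝ) + S2.card ≤ α * n →
      4 * T ^ 2 * (Fintype.card (A × A) ^ 2 * Fintype.card (B × B)) ≤
        (2 : ℝ) ^ (n - S1.card) * 2 ^ (n - S2.card)) :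
    ∃ c : Code 2 n M C, (∀ d, c.errProb d = 0) ∧
      ∀ d, ∀ S1 S2 : Finset (Fin n), (S1.card : ℝ) + S2.card ≤ α * n →
        |c.leak d S1 S2| ≤ 8 * Real.log (1 + 2 * δ) := by
  set p := Fintype.card (A × A) with hp
  set g := Fintype.card (B × B) with hg
  have hp1 : (1 : ℝ) ≤ p := by exact_mod_cast Fintype.card_pos
  have hg1 : (1 : ℝ) ≤ g := by exact_mod_cast Fintype.card_pos
  have hpg : (p : ℝ) * g ≤ 2 ^ n := by
    nlinarith [mul_nonneg (zero_le_one.trans hp1) (zero_le_one.trans hg1)]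
  have hpn : (p : ℝ) ≤ 2 ^ n := by nlinarith
  have hr1 : (1 : ℝ) ≤ 1 + 2 * δ := by linarith
  have hr0 : (0 : ℝ) ≤ 1 + 2 * δ := by linarith
  have hexp := Real.exp_pos (-(δ ^ 2 * T / 4))
  let Q : Finset (Fin n) × (Fin n → Bool) → Finset (Fin n → Bool) := fun i =>
    Finset.univ.filter fun x => tap i.1 x = tap i.1 i.2
  have hQ : ∀ i, ((Q i).card : ℝ) = 2 ^ (n - i.1.card) := fun i => by
    exact_mod_cast card_tap_eq_tap i.1 i.2
  have hI : (Fintype.card (Finset (Fin n) × (Fin n → Bool)) : ℝ) = 2 ^ n * 2 ^ n := by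
    simp
  have h64 : (64 : ℝ) ^ n = 2 ^ n * 2 ^ n * 2 ^ n * 2 ^ n * (2 ^ n * 2 ^ n) := by
    simp only [← mul_pow]; norm_num
  have h2n : (1 : ℝ) ≤ 2 ^ n := one_le_pow₀ (by norm_num)
  have hsmall : ∀ N : ℝ, N ≤ 2 * 64 ^ n → N * (2 * Real.exp (-(δ ^ 2 * T / 4))) < 1 := by
    intro N hN
    have := mul_le_mul_of_nonneg_right hN (by positivity :
      0 ≤ 2 * Real.exp (-(δ ^ 2 * T / 4)))
    linarith
  have hq : (2 : ℝ) ^ n * 2 ^ n * 2 ^ n ≤ 64 ^ n := by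
    rw [h64]
    have h3 : (1 : ℝ) ≤ 2 ^ n * (2 ^ n * 2 ^ n) := by
      nlinarith [mul_le_mul h2n h2n zero_le_one (by positivity)]
    calc (2 : ℝ) ^ n * 2 ^ n * 2 ^ n ≤ (2 ^ n * 2 ^ n * 2 ^ n) * (2 ^ n * (2 ^ n * 2 ^ n)) :=
          le_mul_of_one_le_right (by positivity) h3
      _ = _ := by ring
  obtain ⟨h, F, hh, hF, hhF⟩ := exists_balanced_pair (P := A × A) (G := B × B) Q δ T hδ0 hδ hT
    (by
      refine hsmall _ ?_
      push_cast
      rw [hI]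
      have h1 := mul_le_mul_of_nonneg_left hpn (by positivity : (0 : ℝ) ≤ 2 ^ n * 2 ^ n)
      have h2 := mul_le_mul_of_nonneg_left hpg (by positivity : (0 : ℝ) ≤ 2 ^ n * 2 ^ n)
      linarith)
    (by
      refine hsmall _ ?_
      push_cast
      rw [hI]
      have h1 := mul_le_mul_of_nonneg_left hpn (by positivity : (0 : ℝ) ≤ 2 ^ n * 2 ^ n)
      have h2 : (p : ℝ) * (p * g) ≤ 2 ^ n * 2 ^ n :=
        mul_le_mul hpn hpg (by positivity) (by positivity)
      have h3 := mul_le_mul_of_nonneg_left h2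
        (by positivity : (0 : ℝ) ≤ 2 ^ n * 2 ^ n * (2 ^ n * 2 ^ n))
      linarith)
  simp only [← hp, ← hg] at hh hF hhF
  have huniv : Q (∅, fun _ => false) = Finset.univ :=
    Finset.filter_true_of_mem fun x _ => by rw [tap_eq_tap_iff]; simp
  have hX : ((Finset.univ : Finset (Fin n → Bool)).card : ℝ) = 2 ^ n := by simp
  have hh' : ∀ y, Near (1 + 2 * δ) ((Finset.univ.filter fun x => (h x).1 = y).card : ℝ)
      (2 ^ n / p) := fun y => by
    have h1 := hh (∅, fun _ => false) y
    rw [huniv, hX] at h1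
    exact h1 (Or.inr (by nlinarith [mul_nonneg (zero_le_one.trans hp1) (zero_le_one.trans hT)]))
  have hF' : ∀ y, Near (1 + 2 * δ) ((Finset.univ.filter fun x => F x = y).card : ℝ)
      (2 ^ n / (p * g)) := fun y => by
    have h1 := hF (∅, fun _ => false) y
    rw [huniv, hX] at h1
    exact h1 hsize
  have hpos : ∀ (s : Finset (Fin n → Bool)) (y : ℝ), 0 < y → Near (1 + 2 * δ) (s.card : ℝ) y →
      (0 : ℝ) < s.card := fun s y hy hs => by
    by_contra! h0
    have := hs.2
    nlinarith
  have hhpos : ∀ y, (0 : ℝ) < (Finset.univ.filter fun x => (h x).1 = y).card := fun y =>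
    hpos _ _ (by positivity) (hh' y)
  have hFpos : ∀ y, (0 : ℝ) < (Finset.univ.filter fun x => F x = y).card := fun y =>
    hpos _ _ (by positivity) (hF' y)
  obtain ⟨c, hc0, hc⟩ := exists_code_of_labels (C := C) hM hC hMAB h F
    (fun y => Finset.card_pos.1 (by exact_mod_cast hhpos y))
    (fun y => Finset.card_pos.1 (by exact_mod_cast hFpos y))
  refine ⟨c, hc0, fun d S1 S2 hS => ?_⟩
  have hlog : 2 * Real.log (((1 + 2 * δ) * (1 + 2 * δ)) * ((1 + 2 * δ) * (1 + 2 * δ))) =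
      8 * Real.log (1 + 2 * δ) := by
    have : 1 + 2 * δ ≠ 0 := by linarith
    rw [Real.log_mul (by positivity) (by positivity), Real.log_mul this this]
    ring
  rw [← hlog]
  refine c.abs_leak_le hM d S1 S2
    (fun z => ((Finset.univ.filter fun x => tap S1 x = z.1).card : ℝ) *
      (Finset.univ.filter fun x => tap S2 x = z.2).card / (2 ^ n * 2 ^ n))
    (one_le_mul_of_one_le_of_one_le (one_le_mul_of_one_le_of_one_le hr1 hr1)
      (one_le_mul_of_one_le_of_one_le hr1 hr1)) fun w z => ?_
  obtain ⟨y, q, κ, hsum⟩ := hc d S1 S2 w z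
  rw [hsum]
  have hN : Near ((1 + 2 * δ) * (1 + 2 * δ))
      (∑ x ∈ (Finset.univ.filter fun x => tap S1 x = z.1).filter fun x => (h x).1 = y,
        (((Finset.univ.filter fun x => tap S2 x = z.2).filter fun b =>
          F b = (q, κ - (h x).2)).card : ℝ))
      (((Finset.univ.filter fun x => tap S1 x = z.1).card : ℝ) *
        (Finset.univ.filter fun x => tap S2 x = z.2).card / (p ^ 2 * g)) := by
    by_cases hz1 : ∃ x, tap S1 x = z.1
    · by_cases hz2 : ∃ x, tap S2 x = z.2
      · obtain ⟨x1, hx1⟩ := hz1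
        obtain ⟨x2, hx2⟩ := hz2
        rw [← hx1, ← hx2]
        have hwide' : ∀ S x, (S.card : ℝ) ≤ α * n → p = 1 ∨ p * T ≤ ((Q (S, x)).card : ℝ) :=
          fun S x hSα => hwide.imp_right fun hw => by rw [hQ]; exact hw S hSα
        refine hhF (S1, x1) (S2, x2) y q κ (hwide' _ _ ?_) (hwide' _ _ ?_) ?_
        · linarith [(Nat.cast_nonneg S2.card : (0 : ℝ) ≤ _)]
        · linarith [(Nat.cast_nonneg S1.card : (0 : ℝ) ≤ _)]
        · rw [hQ, hQ]; exact hpair S1 S2 hS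
      · rw [Finset.filter_false_of_mem (p := fun x => tap S2 x = z.2)
          fun x _ hx => hz2 ⟨x, hx⟩]
        simp [Near]
    · rw [Finset.filter_false_of_mem (p := fun x => tap S1 x = z.1)
        fun x _ hx => hz1 ⟨x, hx⟩]
      simp [Near]
  refine Near.trans (by positivity) (by positivity) (Near.sum fun x _ => Near.const_mul
    (Nat.cast_nonneg _) (Near.mul hr0 (by positivity) (by positivity) (by positivity)
      (by positivity) ((hF' (q, κ - (h x).2)).inv (hFpos _) (by positivity))
      ((hh' y).inv (hhpos _) (by positivity)))) ?_
  rw [← Finset.sum_mul]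
  convert hN.const_mul (c := (2 ^ n / (p * g) : ℝ)⁻¹ * (2 ^ n / p : ℝ)⁻¹) (by positivity) using 1
  · ring
  · field_simp

/-! ### Achievability -/

theorem msgCount_pos {n : ℕ} {R : ℝ} (hR : 0 ≤ R) : 0 < msgCount n R :=
  Nat.floor_pos.2 (Real.one_le_rpow (by norm_num) (by positivity))

theorem cacheSize_pos (n : ℕ) : 0 < cacheSize n :=
  Nat.floor_pos.2 (Real.one_le_rpow (by norm_num) (by positivity))

theorem nonempty_code {D n M C : ℕ} (hM : 0 < M) (hC : 0 < C) : Nonempty (Code D n M C) :=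
  ⟨{ nr := 0
     q := fun _ => 1
     q_nonneg := fun _ => zero_le_one
     q_sum := by simp
     encC := fun _ _ _ => false
     cacheF := fun _ _ => ⟨0, hC⟩
     encD := fun _ _ _ _ => false
     dec := fun _ _ _ _ => ⟨0, hM⟩ }⟩

/-- Achievability only needs good codes for all sufficiently large blocklengths. -/
theorem achievable_of_eventually {α R : ℝ} (hR : 0 ≤ R) {δ : ℕ → ℝ}
    (hδ : Tendsto δ atTop (nhds 0))
    (h : ∀ᶠ n in atTop, ∃ c : Code 2 n (msgCount n R) (cacheSize n), (∀ d, c.errProb d = 0) ∧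
      ∀ d, ∀ S1 S2 : Finset (Fin n), (S1.card : ℝ) + S2.card ≤ α * n →
        |c.leak d S1 S2| ≤ δ n) : Achievable 2 α R := by
  classical
  let good : ∀ n, Code 2 n (msgCount n R) (cacheSize n) → Prop := fun n c =>
    (∀ d, c.errProb d = 0) ∧ ∀ d, ∀ S1 S2 : Finset (Fin n),
      (S1.card : ℝ) + S2.card ≤ α * n → |c.leak d S1 S2| ≤ δ n
  have hc : ∀ n, ∃ c, (∃ c', good n c') → good n c := fun n => by
    by_cases hn : ∃ c', good n c'
    · exact ⟨hn.choose, fun _ => hn.choose_spec⟩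
    · obtain ⟨c⟩ := nonempty_code (D := 2) (n := n) (msgCount_pos (n := n) hR) (cacheSize_pos n)
      exact ⟨c, fun hn' => absurd hn' hn⟩
  choose c hc using hc
  have hgood : ∀ᶠ n in atTop, good n (c n) := h.mono fun n hn => hc n hn
  refine ⟨c, fun n => if good n (c n) then 0 else ∑ d, |(c n).errProb d|,
    fun n => if good n (c n) then δ n else
      ∑ x : (Fin 2 × Fin 2) × Finset (Fin n) × Finset (Fin n), |(c n).leak x.1 x.2.1 x.2.2|,
    ?_, ?_, fun n d => ?_, fun n d S1 S2 hS => ?_⟩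
  · exact tendsto_const_nhds.congr' (hgood.mono fun n hn => (if_pos hn).symm)
  · exact hδ.congr' (hgood.mono fun n hn => (if_pos hn).symm)
  · dsimp only
    split_ifs with hn
    · exact (hn.1 d).le
    · exact (le_abs_self _).trans (Finset.single_le_sum (f := fun d => |(c n).errProb d|)
        (fun _ _ => abs_nonneg _) (Finset.mem_univ d))
  · dsimp only
    split_ifs with hn
    · exact hn.2 d S1 S2 hS
    · have hsum : ∀ f : (Fin 2 × Fin 2) × Finset (Fin n) × Finset (Fin n) → ℝ,
          (∀ x, 0 ≤ f x) → f (d, S1, S2) ≤ ∑ x, f x := fun f hf =>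
        Finset.single_le_sum (fun x _ => hf x) (Finset.mem_univ _)
      exact hsum (fun x => |(c n).leak x.1 x.2.1 x.2.2|) fun _ => abs_nonneg _

theorem eventually_mul_exp_lt {a : ℝ} (ha : 0 < a) :
    ∀ᶠ n : ℕ in atTop, 4 * (64 : ℝ) ^ n * Real.exp (-(Real.exp (a * n) / 4)) < 1 := by
  have hlarge := (tendsto_natCast_atTop_atTop (R := ℝ)).const_mul_atTop
    (by positivity : 0 < a ^ 2 / 8)
  filter_upwards [hlarge.eventually_ge_atTop (Real.log 4 + Real.log 64), eventually_ge_atTop 1]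
    with n hn hn1
  have hn1' : (1 : ℝ) ≤ n := by exact_mod_cast hn1
  have h4 : (0 : ℝ) < Real.log 4 := Real.log_pos (by norm_num)
  have hquad := Real.quadratic_le_exp_of_nonneg (x := a * n) (by positivity)
  have hpow : 4 * (64 : ℝ) ^ n = Real.exp (Real.log 4 + n * Real.log 64) := by
    rw [Real.exp_add, Real.exp_nat_mul, Real.exp_log (by norm_num), Real.exp_log (by norm_num)]
  rw [hpow, ← Real.exp_add, Real.exp_lt_one_iff]
  have := mul_le_mul_of_nonneg_right hn (Nat.cast_nonneg n : (0 : ℝ) ≤ n)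
  have han : 0 < a * n := by positivity
  nlinarith

theorem two_pow_eq_exp (m : ℕ) : (2 : ℝ) ^ m = Real.exp (Real.log 2 * m) := by
  rw [mul_comm, Real.exp_nat_mul, Real.exp_log (by norm_num)]

theorem two_pow_sub_card_eq_exp {n : ℕ} (S : Finset (Fin n)) :
    (2 : ℝ) ^ (n - S.card) = Real.exp (Real.log 2 * (n - S.card)) := by
  rw [two_pow_eq_exp, Nat.cast_sub (by simpa using Finset.card_le_univ S)]

/-- Achievability from a splitting of the files into parts of `c`, `c` and `k` bits. -/
theorem achievable_of_split {α R e : ℝ} (he : 0 < e) (hR : 0 ≤ R)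
    (h : ∀ᶠ n : ℕ in atTop, ∃ c k : ℕ, 2 * c + 2 * k + e * n ≤ (n : ℝ) ∧
      n * R ≤ 2 * c + k ∧ (c = 0 ∨ 2 * c + e * n ≤ n - α * n) ∧
      4 * c + 2 * k + 2 * e * n + 2 ≤ (2 - α) * n) : Achievable 2 α R := by
  have hL : 0 < Real.log 2 := Real.log_pos (by norm_num)
  have hnat : Tendsto (fun n : ℕ => (n : ℝ)) atTop atTop := tendsto_natCast_atTop_atTop
  have hδ : Tendsto (fun n : ℕ => Real.exp (-(e * Real.log 2 / 4 * n))) atTop (nhds 0) :=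
    Real.tendsto_exp_neg_atTop_nhds_zero.comp (hnat.const_mul_atTop (by positivity))
  have hleak : Tendsto (fun n : ℕ => 8 * Real.log (1 + 2 * Real.exp (-(e * Real.log 2 / 4 * n))))
      atTop (nhds 0) := by
    have h1 : Tendsto (fun n : ℕ => 1 + 2 * Real.exp (-(e * Real.log 2 / 4 * n))) atTop
        (nhds 1) := by simpa using (hδ.const_mul 2).const_add 1
    simpa using (h1.log one_ne_zero).const_mul 8
  refine achievable_of_eventually hR hleak ?_
  filter_upwards [h, eventually_mul_exp_lt (a := e * Real.log 2 / 2) (by positivity),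
    hδ.eventually_le_const (by norm_num : (0 : ℝ) < 1 / 2)] with n hn hexp hhalf
  obtain ⟨c, k, hsize, hrate, hwide, hpair⟩ := hn
  have hcardA : Fintype.card (ZMod (2 ^ c)) = 2 ^ c := ZMod.card _
  have hcardB : Fintype.card (ZMod (2 ^ k)) = 2 ^ k := ZMod.card _
  have hA2 : (Fintype.card (ZMod (2 ^ c) × ZMod (2 ^ c)) : ℝ) =
      Real.exp (Real.log 2 * (2 * c)) := by
    rw [Fintype.card_prod, hcardA]
    push_cast
    rw [two_pow_eq_exp, ← Real.exp_add]
    ring_nf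
  have hB2 : (Fintype.card (ZMod (2 ^ k) × ZMod (2 ^ k)) : ℝ) =
      Real.exp (Real.log 2 * (2 * k)) := by
    rw [Fintype.card_prod, hcardB]
    push_cast
    rw [two_pow_eq_exp, ← Real.exp_add]
    ring_nf
  have h4 : (4 : ℝ) = Real.exp (Real.log 2 * 2) := by
    rw [Real.exp_mul, Real.exp_log (by norm_num)]; norm_num
  refine exists_secure_code (A := ZMod (2 ^ c)) (B := ZMod (2 ^ k))
    (T := Real.exp (e * Real.log 2 * n)) (msgCount_pos hR) ?_ ?_ (Real.exp_pos _).le hhalf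
    (Real.one_le_exp (by positivity)) ?_ ?_ ?_ ?_
  · rw [hcardA, hcardB, ← pow_add]
    refine Nat.le_floor ?_
    push_cast
    rw [← Real.rpow_natCast]
    refine Real.rpow_le_rpow_of_exponent_le (by norm_num) ?_
    push_cast
    nlinarith [(Nat.cast_nonneg n : (0 : ℝ) ≤ n)]
  · rw [hcardA, hcardB, ← pow_add, ← pow_add]
    refine Nat.floor_le_of_le ?_
    push_cast
    rw [← Real.rpow_natCast]
    refine Real.rpow_le_rpow_of_exponent_le (by norm_num) ?_
    push_cast
    linarith
  · convert hexp using 5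
    rw [← Real.exp_nat_mul, ← Real.exp_add]
    push_cast
    ring_nf
  · rw [hA2, hB2, two_pow_eq_exp, ← Real.exp_add, ← Real.exp_add, Real.exp_le_exp]
    nlinarith
  · rcases hwide with rfl | hwide
    · left
      rw [Fintype.card_prod, hcardA]
      rfl
    · right
      intro S hS
      rw [hA2, two_pow_sub_card_eq_exp, ← Real.exp_add, Real.exp_le_exp]
      nlinarith
  · intro S1 S2 hS
    rw [hA2, hB2, two_pow_sub_card_eq_exp, two_pow_sub_card_eq_exp, h4, ← Real.exp_nat_mul,
      ← Real.exp_nat_mul, ← Real.exp_add, ← Real.exp_add, ← Real.exp_add, ← Real.exp_add,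
      Real.exp_le_exp]
    push_cast
    nlinarith

theorem achievable_of_lt {α R : ℝ} (hα : 0 < α) (hR : 0 ≤ R) (hRα : R < 1 - α / 2) :
    Achievable 2 α R := by
  obtain ⟨η, hη⟩ : ∃ η, η = 1 - α / 2 - R := ⟨_, rfl⟩
  have hη0 : 0 < η := by linarith
  have hnat : Tendsto (fun n : ℕ => (n : ℝ)) atTop atTop := tendsto_natCast_atTop_atTop
  rcases le_or_gt 1 α with hα1 | hα1
  · refine achievable_of_split (e := η / 2) (by positivity) hR ?_
    filter_upwards [(hnat.const_mul_atTop hη0).eventually_ge_atTop 4] with n hn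
    have hk := (Nat.ceil_lt_add_one (by positivity : 0 ≤ n * R)).le
    have hαn := mul_le_mul_of_nonneg_right hα1 (Nat.cast_nonneg n : (0 : ℝ) ≤ n)
    have hRn : n * R = n - α * n / 2 - η * n := by rw [hη]; ring
    refine ⟨0, ⌈n * R⌉₊, ?_, ?_, Or.inl rfl, ?_⟩
    · push_cast; linarith
    · have := Nat.le_ceil (n * R)
      push_cast; linarith
    · push_cast; linarith
  · obtain ⟨e, he⟩ : ∃ e, e = min (η / 4) ((1 - α) / 2) := ⟨_, rfl⟩
    have he0 : 0 < e := by rw [he]; exact lt_min (by positivity) (by linarith)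
    have he1 : e ≤ η / 4 := he.trans_le (min_le_left _ _)
    have he2 : e ≤ (1 - α) / 2 := he.trans_le (min_le_right _ _)
    refine achievable_of_split he0 hR ?_
    filter_upwards [(hnat.const_mul_atTop hη0).eventually_ge_atTop 6,
      (hnat.const_mul_atTop he0).eventually_ge_atTop 1] with n hn hen
    have hn0 : (0 : ℝ) ≤ n := Nat.cast_nonneg n
    have hen' := mul_le_mul_of_nonneg_right he1 hn0
    have hc := Nat.floor_le (mul_nonneg (sub_nonneg.2 he2) hn0)
    have hc' := Nat.lt_floor_add_one (((1 - α) / 2 - e) * n)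
    have hk := Nat.floor_le (by positivity : 0 ≤ α * n / 2)
    have hk' := Nat.lt_floor_add_one (α * n / 2)
    have hRn : n * R = n - α * n / 2 - η * n := by rw [hη]; ring
    refine ⟨⌊((1 - α) / 2 - e) * n⌋₊, ⌊α * n / 2⌋₊, ?_, ?_, Or.inr ?_, ?_⟩ <;> linarith

/-! ### Converse -/

theorem nonneg_of_achievable {α R : ℝ} (h : Achievable 2 α R) : 0 ≤ R := by
  obtain ⟨c, -⟩ := h
  by_contra! hR
  have hM : msgCount 1 R = 0 := by
    simpa [msgCount, Nat.floor_eq_zero] using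
      Real.rpow_lt_one_of_one_lt_of_neg (by norm_num : (1 : ℝ) < 2) hR
  exact (Fin.cast hM ((c 1).dec (0, 0) 0 ((c 1).cacheF 0 fun _ => false) fun _ => false)).elim0

/-- The pairs of files and observations that are consistent with the decoders. -/
noncomputable def Code.consistent {n M C : ℕ} (c : Code 2 n M C) (S1 S2 : Finset (Fin n)) :
    Finset ((Fin 2 → Fin M) × (Fin n → Option Bool) × (Fin n → Option Bool)) :=
  Finset.univ.filter fun x => ∃ y : (Fin n → Bool) × (Fin n → Bool),
    (tap S1 y.1 = x.2.1 ∧ tap S2 y.2 = x.2.2) ∧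
      ![c.dec (0, 1) 0 (c.cacheF 0 y.1) y.2, c.dec (0, 1) 1 (c.cacheF 1 y.1) y.2] = x.1

set_option synthInstance.maxSize 256 in
theorem Code.card_consistent_le {n M C : ℕ} (c : Code 2 n M C) (S1 S2 : Finset (Fin n))
    (z : (Fin n → Option Bool) × (Fin n → Option Bool)) :
    (Finset.univ.filter fun w : Fin 2 → Fin M => (w, z) ∈ c.consistent S1 S2).card ≤
      2 ^ (n - S1.card) * 2 ^ (n - S2.card) := by
  have hsub : (Finset.univ.filter fun w : Fin 2 → Fin M => (w, z) ∈ c.consistent S1 S2) ⊆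
      ((Finset.univ.filter fun x => tap S1 x = z.1) ×ˢ
        (Finset.univ.filter fun x => tap S2 x = z.2)).image fun y =>
          ![c.dec (0, 1) 0 (c.cacheF 0 y.1) y.2, c.dec (0, 1) 1 (c.cacheF 1 y.1) y.2] := by
    intro w hw
    simp only [Code.consistent, Finset.mem_filter, Finset.mem_univ, true_and] at hw
    simpa only [Finset.mem_image, Finset.mem_product, Finset.mem_filter, Finset.mem_univ,
      true_and] using hw
  refine (Finset.card_le_card hsub).trans (Finset.card_image_le.trans ?_)
  rw [Finset.card_product]
  exact Nat.mul_le_mul (card_tap_eq_le S1 z.1) (card_tap_eq_le S2 z.2)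

theorem sum_dist_eq_sum_ite {Ω A : Type*} [Fintype Ω] [DecidableEq A] (P : Ω → ℝ) (X : Ω → A)
    (E : Finset A) : ∑ x ∈ E, dist P X x = ∑ ω, if X ω ∈ E then P ω else 0 := by
  simp only [dist]
  rw [Finset.sum_comm]
  simp

theorem Code.le_leak {n M C : ℕ} (c : Code 2 n M C) (hM : 0 < M) (S1 S2 : Finset (Fin n)) :
    1 - c.errProb (0, 1) - 2 * (2 ^ (n - S1.card) * 2 ^ (n - S2.card) / (M : ℝ) ^ 2) ≤
      c.leak (0, 1) S1 S2 := by
  refine le_trans (sub_le_sub ?_ (mul_le_mul_of_nonneg_left ?_ zero_le_two))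
    (sub_two_mul_le_mutInfo c.P_nonneg (c.sum_P hM) (c.consistent S1 S2))
  · rw [sum_dist_eq_sum_ite, sub_le_iff_le_add, ← c.sum_P hM, Code.errProb,
      ← Finset.sum_add_distrib]
    refine Finset.sum_le_sum fun ω _ => ?_
    have hω := c.P_nonneg ω
    by_cases he : c.dec (0, 1) 0 (c.cacheF 0 (c.encC ω.1 ω.2)) (c.encD (0, 1) ω.1 ω.2) ≠ ω.1 0 ∨
        c.dec (0, 1) 1 (c.cacheF 1 (c.encC ω.1 ω.2)) (c.encD (0, 1) ω.1 ω.2) ≠ ω.1 1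
    · rw [if_pos he]
      split_ifs <;> linarith
    · rw [if_neg he, add_zero, if_pos]
      push Not at he
      simp only [Code.consistent, Finset.mem_filter, Finset.mem_univ, true_and]
      refine ⟨(c.encC ω.1 ω.2, c.encD (0, 1) ω.1 ω.2), ⟨rfl, rfl⟩, ?_⟩
      funext i
      fin_cases i
      · exact he.1
      · exact he.2
  · set Z := fun ωθ : (Fin 2 → Fin M) × Fin (c.nr + 1) =>
      (tap S1 (c.encC ωθ.1 ωθ.2), tap S2 (c.encD (0, 1) ωθ.1 ωθ.2))
    calc ∑ x ∈ c.consistent S1 S2, dist c.P (fun ω => ω.1) x.1 * dist c.P Z x.2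
        = ∑ z, ∑ w, if (w, z) ∈ c.consistent S1 S2 then
            1 / (M : ℝ) ^ 2 * dist c.P Z z else 0 := by
          rw [← Fintype.sum_prod_type_right
            (fun x => if x ∈ c.consistent S1 S2 then 1 / (M : ℝ) ^ 2 * dist c.P Z x.2 else 0),
            ← Finset.sum_filter, Finset.filter_univ_mem]
          exact Finset.sum_congr rfl fun x _ => by rw [c.dist_message]
      _ ≤ ∑ z, 2 ^ (n - S1.card) * 2 ^ (n - S2.card) / (M : ℝ) ^ 2 * dist c.P Z z := by
          refine Finset.sum_le_sum fun z _ => ?_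
          rw [← Finset.sum_filter, Finset.sum_const, nsmul_eq_mul, ← mul_assoc, mul_one_div]
          have := dist_nonneg c.P_nonneg Z z
          gcongr
          exact_mod_cast c.card_consistent_le S1 S2 z
      _ = 2 ^ (n - S1.card) * 2 ^ (n - S2.card) / (M : ℝ) ^ 2 := by
          rw [← Finset.mul_sum, sum_dist, c.sum_P hM, mul_one]

theorem exists_tapping_sets {α : ℝ} (h0 : 0 < α) (h2 : α ≤ 2) (n : ℕ) :
    ∃ S1 S2 : Finset (Fin n), (S1.card : ℝ) + S2.card ≤ α * n ∧
      (2 : ℝ) ^ (n - S1.card) * 2 ^ (n - S2.card) ≤ 2 * 2 ^ ((2 - α) * n) := by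
  have hα : 0 ≤ α * n := by positivity
  have hb := Nat.floor_le hα
  have hb' := Nat.lt_floor_add_one (α * n)
  have hb2 : ⌊α * n⌋₊ ≤ 2 * n := Nat.floor_le_of_le (by push_cast; gcongr)
  set b := ⌊α * n⌋₊
  obtain ⟨S1, -, hS1⟩ := Finset.exists_subset_card_eq (s := (Finset.univ : Finset (Fin n)))
    (n := min n b) (by simp)
  obtain ⟨S2, -, hS2⟩ := Finset.exists_subset_card_eq (s := (Finset.univ : Finset (Fin n)))
    (n := b - min n b) (by simp; omega)
  have hsum : S1.card + S2.card = b := by omega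
  refine ⟨S1, S2, ?_, ?_⟩
  · rw [← Nat.cast_add, hsum]
    exact hb
  · have hexp : n - S1.card + (n - S2.card) = 2 * n - b := by omega
    rw [← pow_add, hexp, ← Real.rpow_natCast, Nat.cast_sub hb2]
    calc (2 : ℝ) ^ (((2 * n : ℕ) : ℝ) - b) ≤ 2 ^ (1 + (2 - α) * n) := by
          refine Real.rpow_le_rpow_of_exponent_le one_le_two ?_
          push_cast
          linarith
      _ = 2 * 2 ^ ((2 - α) * n) := by rw [Real.rpow_add two_pos, Real.rpow_one]

theorem rpow_le_two_mul_msgCount {n : ℕ} {R : ℝ} (hR : 0 ≤ R) :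
    (2 : ℝ) ^ ((n : ℝ) * R) ≤ 2 * msgCount n R := by
  have h1 : (1 : ℝ) ≤ msgCount n R := by exact_mod_cast msgCount_pos (n := n) hR
  have := Nat.lt_floor_add_one ((2 : ℝ) ^ ((n : ℝ) * R))
  rw [← msgCount] at this
  linarith

theorem le_of_achievable {α R : ℝ} (h0 : 0 < α) (h2 : α ≤ 2) (h : Achievable 2 α R) :
    R ≤ 1 - α / 2 := by
  have hR := nonneg_of_achievable h
  obtain ⟨c, ε, δ, hε, hδ, herr, hleak⟩ := h
  by_contra! hlt
  have hgap : 0 < Real.log 2 * (2 * R - (2 - α)) :=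
    mul_pos (Real.log_pos one_lt_two) (by linarith)
  have hbound : ∀ n : ℕ, 1 - ε n - 16 * Real.exp (-(Real.log 2 * (2 * R - (2 - α)) * n)) ≤
      δ n := by
    intro n
    obtain ⟨S1, S2, hS, hpow⟩ := exists_tapping_sets h0 h2 n
    have hM := msgCount_pos (n := n) hR
    have hM' : (0 : ℝ) < msgCount n R := by exact_mod_cast hM
    have hle := ((c n).le_leak hM S1 S2).trans
      ((le_abs_self _).trans (hleak n (0, 1) S1 S2 hS))
    have hratio : (2 : ℝ) ^ (n - S1.card) * 2 ^ (n - S2.card) / (msgCount n R : ℝ) ^ 2 ≤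
        8 * Real.exp (-(Real.log 2 * (2 * R - (2 - α)) * n)) := by
      rw [div_le_iff₀ (by positivity)]
      have hexp : (2 : ℝ) ^ ((2 - α) * n) =
          Real.exp (-(Real.log 2 * (2 * R - (2 - α)) * n)) * (2 ^ ((n : ℝ) * R)) ^ 2 := by
        rw [Real.rpow_def_of_pos two_pos, Real.rpow_def_of_pos two_pos, ← Real.exp_nat_mul,
          ← Real.exp_add]
        push_cast
        ring_nf
      have hsq := pow_le_pow_left₀ (by positivity) (rpow_le_two_mul_msgCount (n := n) hR) 2
      have := mul_le_mul_of_nonneg_left hsq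
        (Real.exp_pos (-(Real.log 2 * (2 * R - (2 - α)) * n))).le
      linarith
    linarith [herr n (0, 1)]
  have hexp : Tendsto (fun n : ℕ => Real.exp (-(Real.log 2 * (2 * R - (2 - α)) * n))) atTop
      (nhds 0) :=
    Real.tendsto_exp_neg_atTop_nhds_zero.comp
      (tendsto_natCast_atTop_atTop.const_mul_atTop hgap)
  have := le_of_tendsto_of_tendsto' ((hε.const_sub 1).sub (hexp.const_mul 16)) hδ hbound
  norm_num at this

end CBC

open CBC in
/-- **Theorem 1.** For every tapped ratio `0 < α ≤ 2` and a library of `D = 2`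
files, the strong secrecy capacity of the CBC-WCT II equals `1 - α/2`. -/
theorem strong_secrecy_capacity_two_files (α : ℝ) (h0 : 0 < α) (h2 : α ≤ 2) :
    capacity 2 α = 1 - α / 2 := by
  have hle : ∀ R ∈ {R : ℝ | Achievable 2 α R}, R ≤ 1 - α / 2 := fun R hR =>
    le_of_achievable h0 h2 hR
  have hnonneg : 0 ≤ capacity 2 α := Real.sSup_nonneg fun R hR => nonneg_of_achievable hR
  refine le_antisymm (Real.sSup_le hle (by linarith)) (le_of_forall_lt fun R hR => ?_)
  obtain ⟨R', hR1, hR2⟩ := exists_between hR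
  rcases le_or_gt 0 R' with h | h
  · exact hR1.trans_le (le_csSup ⟨_, hle⟩ (achievable_of_lt h0 h hR2))
  · exact (hR1.trans h).trans_le hnonneg
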